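/- Let φ : ℂ* → ℂ* be a conjugating mapping, i.e. a bijection such that for every holomorphic f : ℂ* → ℂ* the map φ ∘ f ∘ φ⁻¹ : ℂ* → ℂ* is holomorphic. Then φ is biholomorphic or anti-biholomorphic: either φ is holomorphic with holomorphic inverse, or the map z ↦ φ(z̄) is holomorphic with holomorphic inverse. -/

import Mathlib

open Complex Set

noncomputable section

/-- The punctured complex line `ℂ* = ℂ ∖ {0}`. -/
def Cstar : Set ℂ := {z : ℂ | z ≠ 0}

/-- A holomorphic self-map of `ℂ*` (represented by a total function whose behaviour
matters only on `ℂ*`). -/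
def CstarEndo (f : ℂ → ℂ) : Prop :=
  DifferentiableOn ℂ f Cstar ∧ Set.MapsTo f Cstar Cstar

/-- A conjugating mapping of `ℂ*`: a bijection of `ℂ*` such that for every holomorphic
self-map `f` of `ℂ*` the conjugate `φ ∘ f ∘ φ⁻¹` is again a holomorphic self-map of `ℂ*`
(expressed as: there is a holomorphic self-map `g` with `g ∘ φ = φ ∘ f` on `ℂ*`). -/
def ConjugatingCstar (φ : ℂ → ℂ) : Prop :=
  Set.BijOn φ Cstar Cstar ∧
    ∀ f, CstarEndo f → ∃ g, CstarEndo g ∧ ∀ z ∈ Cstar, g (φ z) = φ (f z)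

open Filter Topology

lemma isOpen_Cstar : IsOpen Cstar := isOpen_ne

lemma bdd_ext {u : ℂ → ℂ} (hu : DifferentiableOn ℂ u Cstar)
    (h0 : ∃ C : ℝ, ∀ᶠ z in 𝓝[≠] (0:ℂ), ‖u z‖ ≤ C) :
    ∃ v : ℂ → ℂ, Differentiable ℂ v ∧ ∀ z, z ≠ 0 → v z = u z := by
  obtain ⟨C, hC⟩ := h0
  refine ⟨Function.update u 0 (limUnder (𝓝[≠] (0:ℂ)) u), ?_, ?_⟩
  · rw [← differentiableOn_univ]
    refine Complex.differentiableOn_update_limUnder_of_isLittleO univ_mem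
      (hu.mono (by intro z hz; exact hz.2)) ?_
    refine IsBoundedUnder.isLittleO_sub_self_inv ⟨C + ‖u 0‖, ?_⟩
    rw [eventually_map]
    filter_upwards [hC] with z hz
    exact norm_sub_le_of_le hz le_rfl
  · intro z hz
    simp [Function.update_of_ne hz]

lemma liouville_star {u : ℂ → ℂ} (hu : DifferentiableOn ℂ u Cstar)
    (h0 : ∃ C : ℝ, ∀ᶠ z in 𝓝[≠] (0:ℂ), ‖u z‖ ≤ C)
    (h1 : ∃ C : ℝ, ∀ᶠ z in 𝓝[≠] (0:ℂ), ‖u z⁻¹‖ ≤ C) :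
    ∃ c, ∀ z, z ≠ 0 → u z = c := by
  obtain ⟨v, hv, huv⟩ := bdd_ext hu h0
  obtain ⟨C, hC⟩ := h1
  rw [eventually_nhdsWithin_iff, Metric.eventually_nhds_iff] at hC
  obtain ⟨ε, hε, hC⟩ := hC
  have hb : Bornology.IsBounded (range v) := by
    obtain ⟨M, hM⟩ := ((isCompact_closedBall (0:ℂ) (ε⁻¹ + 1)).image hv.continuous).isBounded.exists_norm_le
    rw [isBounded_iff_forall_norm_le]
    refine ⟨max M C, ?_⟩
    rintro _ ⟨z, rfl⟩
    by_cases hz : ‖z‖ ≤ ε⁻¹ + 1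
    · exact (hM _ ⟨z, by simpa using hz, rfl⟩).trans (le_max_left _ _)
    · push Not at hz
      have hz0 : z ≠ 0 := by
        rintro rfl
        have := inv_pos.2 hε
        simp at hz; linarith
      have h2 := hC (y := z⁻¹) (by
        rw [dist_zero_right, norm_inv]
        exact inv_lt_of_inv_lt₀ hε (by linarith)) (by simpa using hz0)
      rw [inv_inv] at h2
      rw [huv z hz0]
      exact h2.trans (le_max_right _ _)
  exact ⟨v 0, fun z hz => by rw [← huv z hz]; exact hv.apply_eq_apply_of_bounded hb _ _⟩

/-- pair of mutually inverse holomorphic self maps -/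
structure AutPair (g k : ℂ → ℂ) : Prop where
  hg : CstarEndo g
  hk : CstarEndo k
  kg : ∀ z, z ≠ 0 → k (g z) = z
  gk : ∀ z, z ≠ 0 → g (k z) = z

lemma AutPair.symm {g k : ℂ → ℂ} (h : AutPair g k) : AutPair k g := ⟨h.hk, h.hg, h.gk, h.kg⟩

lemma CstarEndo.ne {g : ℂ → ℂ} (h : CstarEndo g) {z : ℂ} (hz : z ≠ 0) : g z ≠ 0 := h.2 hz

lemma endo_inv {g : ℂ → ℂ} (h : CstarEndo g) : CstarEndo (fun z => (g z)⁻¹) :=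
  ⟨h.1.inv (fun z hz => h.2 hz), fun z hz => inv_ne_zero (h.2 hz)⟩

lemma endo_comp_inv {g : ℂ → ℂ} (h : CstarEndo g) : CstarEndo (fun z => g z⁻¹) :=
  ⟨h.1.comp (differentiableOn_id.inv (fun z hz => hz)) (fun z hz => inv_ne_zero hz),
    fun z hz => h.2 (inv_ne_zero hz : z⁻¹ ≠ 0)⟩

lemma AutPair.inv {g k : ℂ → ℂ} (h : AutPair g k) :
    AutPair (fun z => (g z)⁻¹) (fun z => k z⁻¹) :=
  ⟨endo_inv h.hg, endo_comp_inv h.hk, fun z hz => by simp [h.kg z hz],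
    fun z hz => by simp [h.gk z⁻¹ (inv_ne_zero hz)]⟩

lemma punct_conn {u : ℂ → ℝ} (hu : ContinuousOn u Cstar)
    (h : ∀ᶠ z in 𝓝[≠] (0:ℂ), u z ≠ 1) :
    (∀ᶠ z in 𝓝[≠] (0:ℂ), u z < 1) ∨ (∀ᶠ z in 𝓝[≠] (0:ℂ), 1 < u z) := by
  rw [eventually_nhdsWithin_iff, Metric.eventually_nhds_iff] at h
  obtain ⟨ε, hε, h⟩ := h
  set S : Set ℂ := Complex.exp '' {t : ℂ | t.re < Real.log ε} with hS
  have hSpre : IsPreconnected S :=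
    ((convex_halfSpace_re_lt (Real.log ε)).isPreconnected).image _ Complex.continuous_exp.continuousOn
  have hS1 : ∀ z, ‖z‖ < ε → z ≠ 0 → z ∈ S := by
    intro z hz hz0
    refine ⟨Complex.log z, ?_, Complex.exp_log hz0⟩
    simp only [mem_ofPred_eq, Complex.log_re]
    exact Real.log_lt_log (norm_pos_iff.2 hz0) hz
  have hS2 : ∀ z ∈ S, z ≠ 0 ∧ u z ≠ 1 := by
    rintro _ ⟨t, ht, rfl⟩
    refine ⟨Complex.exp_ne_zero _, h ?_ (Complex.exp_ne_zero _)⟩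
    rw [dist_zero_right, Complex.norm_exp]
    exact (Real.lt_log_iff_exp_lt hε).1 ht
  have hI : IsPreconnected (u '' S) := hSpre.image _ (hu.mono fun z hz => (hS2 z hz).1)
  have hev : ∀ᶠ z in 𝓝[≠] (0:ℂ), z ∈ S := by
    rw [eventually_nhdsWithin_iff, Metric.eventually_nhds_iff]
    exact ⟨ε, hε, fun z hz hz0 => hS1 z (by simpa using hz) hz0⟩
  by_cases hc : ∀ z ∈ S, u z < 1
  · left; exact hev.mono hc
  · right
    push Not at hc
    obtain ⟨z0, hz0, h0⟩ := hc
    refine hev.mono fun z hz => ?_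
    by_contra hlt
    push Not at hlt
    obtain ⟨y, hy, hy1⟩ := hI.Icc_subset (mem_image_of_mem u hz) (mem_image_of_mem u hz0) ⟨hlt, h0⟩
    exact (hS2 y hy).2 hy1

lemma AutPair.dichotomy {g k : ℂ → ℂ} (h : AutPair g k) :
    (∀ᶠ z in 𝓝[≠] (0:ℂ), ‖g z‖ < 1) ∨ (∀ᶠ z in 𝓝[≠] (0:ℂ), 1 < ‖g z‖) := by
  apply punct_conn h.hg.1.continuousOn.norm
  have hK : IsCompact (k '' Metric.sphere (0:ℂ) 1) :=
    (isCompact_sphere _ _).image_of_continuousOn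
      (h.hk.1.continuousOn.mono fun z hz => by
        rintro rfl; simp at hz)
  have h0 : (k '' Metric.sphere (0:ℂ) 1)ᶜ ∈ 𝓝 (0:ℂ) := by
    refine hK.isClosed.isOpen_compl.mem_nhds ?_
    rintro ⟨z, hz, hz0⟩
    exact h.hk.ne (z := z) (by rintro rfl; simp at hz) hz0
  filter_upwards [mem_nhdsWithin_of_mem_nhds h0, self_mem_nhdsWithin] with z hz hz0 h1
  exact hz ⟨g z, by simpa using h1, h.kg z hz0⟩

lemma AutPair.tendsto {g k : ℂ → ℂ} (h : AutPair g k)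
    (hb : ∀ᶠ z in 𝓝[≠] (0:ℂ), ‖g z‖ < 1) :
    Tendsto g (𝓝[≠] 0) (𝓝[≠] 0) ∧ ∃ C : ℝ, ∀ᶠ z in 𝓝[≠] (0:ℂ), ‖g z / z‖ ≤ C := by
  obtain ⟨v, hv, hvg⟩ := bdd_ext h.hg.1 ⟨1, hb.mono fun z hz => hz.le⟩
  have heq : v =ᶠ[𝓝[≠] 0] g := by
    filter_upwards [self_mem_nhdsWithin] with z hz using hvg z hz
  have ht : Tendsto g (𝓝[≠] 0) (𝓝 (v 0)) :=
    ((hv.continuous.tendsto 0).mono_left nhdsWithin_le_nhds).congr' heq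
  have hv0 : v 0 = 0 := by
    by_contra hne
    have h1 : ContinuousAt k (v 0) :=
      (h.hk.1.differentiableAt (isOpen_Cstar.mem_nhds hne)).continuousAt
    have h2 : Tendsto (fun z => k (g z)) (𝓝[≠] 0) (𝓝 (k (v 0))) := h1.tendsto.comp ht
    have h3 : Tendsto (fun z : ℂ => z) (𝓝[≠] 0) (𝓝 (k (v 0))) := by
      refine h2.congr' ?_
      filter_upwards [self_mem_nhdsWithin] with z hz using h.kg z hz
    have h4 : Tendsto (fun z : ℂ => z) (𝓝[≠] 0) (𝓝 0) := tendsto_id.mono_left nhdsWithin_le_nhds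
    exact h.hk.ne hne (tendsto_nhds_unique h3 h4)
  rw [hv0] at ht
  refine ⟨tendsto_nhdsWithin_iff.2 ⟨ht, ?_⟩, ?_⟩
  · filter_upwards [self_mem_nhdsWithin] with z hz using h.hg.ne hz
  · obtain ⟨C, hC⟩ := (hv 0).isBigO_sub.bound
    refine ⟨C, ?_⟩
    filter_upwards [mem_nhdsWithin_of_mem_nhds hC, self_mem_nhdsWithin] with z hz hz0
    simp only [hv0, sub_zero, hvg z hz0] at hz
    rw [norm_div]
    exact div_le_of_le_mul₀ (norm_nonneg _) (by
      by_contra hneg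
      push Not at hneg
      have : 0 < ‖z‖ := norm_pos_iff.2 hz0
      have := norm_nonneg (g z)
      nlinarith) hz

lemma AutPair.linear {g k : ℂ → ℂ} (h : AutPair g k)
    (hb : ∀ᶠ z in 𝓝[≠] (0:ℂ), ‖g z‖ < 1) : ∃ c, c ≠ 0 ∧ ∀ z, z ≠ 0 → g z = c * z := by
  obtain ⟨ht, -⟩ := h.tendsto hb
  -- k is bounded near 0
  have hkb : ∀ᶠ z in 𝓝[≠] (0:ℂ), ‖k z‖ < 1 := by
    rcases h.symm.dichotomy with h1 | h1
    · exact h1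
    · exfalso
      have h2 := ht.eventually h1
      have h3 : ∀ᶠ z in 𝓝[≠] (0:ℂ), ‖z‖ < 1 := by
        apply mem_nhdsWithin_of_mem_nhds
        filter_upwards [Metric.ball_mem_nhds (0:ℂ) one_pos] with z hz
        simpa using hz
      obtain ⟨z, h4, h5, h6⟩ := (h2.and (h3.and self_mem_nhdsWithin)).exists
      rw [h.kg z h6] at h4
      linarith
  obtain ⟨C, hC⟩ := (h.symm.tendsto hkb).2
  have hCg := ht.eventually hC
  -- behaviour at infinity
  have hG := (h.inv.symm.inv).symm
  have hGb : ∀ᶠ z in 𝓝[≠] (0:ℂ), ‖(g z⁻¹)⁻¹‖ < 1 := by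
    rcases hG.dichotomy with h1 | h1
    · exact h1
    · exfalso
      obtain ⟨c, hc⟩ := liouville_star h.hg.1 ⟨1, hb.mono fun z hz => hz.le⟩ ⟨1, by
        filter_upwards [h1, self_mem_nhdsWithin] with z hz hz0
        rw [norm_inv] at hz
        exact (one_lt_inv_iff₀.1 hz).2.le⟩
      have e1 := h.kg 1 one_ne_zero
      have e2 := h.kg 2 two_ne_zero
      rw [hc _ one_ne_zero] at e1
      rw [hc _ two_ne_zero, e1] at e2
      norm_num at e2
  obtain ⟨D, hD⟩ := (hG.tendsto hGb).2
  obtain ⟨c, hc⟩ := liouville_star (u := fun z => z / g z)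
    (differentiableOn_id.div h.hg.1 fun z hz => h.hg.2 hz)
    ⟨C, by
      filter_upwards [hCg, self_mem_nhdsWithin] with z hz hz0
      rwa [h.kg z hz0] at hz⟩
    ⟨D, by
      filter_upwards [hD] with z hz
      convert hz using 2
      rw [div_eq_mul_inv, div_eq_mul_inv, mul_comm]⟩
  have hc0 : c ≠ 0 := by
    rw [← hc 1 one_ne_zero]
    exact div_ne_zero one_ne_zero (h.hg.ne one_ne_zero)
  refine ⟨c⁻¹, inv_ne_zero hc0, fun z hz => ?_⟩
  have := hc z hz
  have h2 := h.hg.ne hz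
  field_simp at this ⊢
  exact this.symm

lemma AutPair.linear_of_no_fix {g k : ℂ → ℂ} (h : AutPair g k)
    (hfix : ∀ z, z ≠ 0 → g z ≠ z) : ∃ c, c ≠ 0 ∧ ∀ z, z ≠ 0 → g z = c * z := by
  rcases h.dichotomy with h1 | h1
  · exact h.linear h1
  · exfalso
    obtain ⟨c, hc0, hc⟩ := h.inv.linear (by
      filter_upwards [h1] with z hz
      rw [norm_inv]
      exact inv_lt_one_of_one_lt₀ hz)
    obtain ⟨s, hs⟩ := IsAlgClosed.exists_pow_nat_eq c⁻¹ (n := 2) two_pos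
    have hs0 : s ≠ 0 := by
      rintro rfl
      simp at hs; exact hc0 hs.symm
    apply hfix s hs0
    have : (g s)⁻¹ = c * s := hc s hs0
    rw [← inv_inv (g s), this]
    have : c = (s^2)⁻¹ := by rw [hs, inv_inv]
    rw [this]; field_simp

/-- normalized conjugating bijection, with inverse -/
structure NConj (φ ψ : ℂ → ℂ) : Prop where
  ne : ∀ z, z ≠ 0 → φ z ≠ 0
  ne' : ∀ z, z ≠ 0 → ψ z ≠ 0
  ψφ : ∀ z, z ≠ 0 → ψ (φ z) = z
  φψ : ∀ z, z ≠ 0 → φ (ψ z) = z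
  one : φ 1 = 1
  conj : ∀ f, CstarEndo f → ∃ g, CstarEndo g ∧ ∀ z, z ≠ 0 → g (φ z) = φ (f z)

lemma endo_mul {a : ℂ} (ha : a ≠ 0) : CstarEndo (fun z => a * z) :=
  ⟨(differentiableOn_const _).mul differentiableOn_id, fun _ hz => mul_ne_zero ha hz⟩

lemma endo_exp {h : ℂ → ℂ} (hh : Differentiable ℂ h) : CstarEndo (fun z => Complex.exp (h z)) :=
  ⟨hh.cexp.differentiableOn, fun _ _ => Complex.exp_ne_zero _⟩

variable {φ ψ : ℂ → ℂ}

lemma NConj.mul (H : NConj φ ψ) {a b : ℂ} (ha : a ≠ 0) (hb : b ≠ 0) :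
    φ (a * b) = φ a * φ b := by
  by_cases ha1 : a = 1
  · subst ha1; simp [H.one]
  obtain ⟨g, hg, hg'⟩ := H.conj _ (endo_mul ha)
  obtain ⟨k, hk, hk'⟩ := H.conj _ (endo_mul (inv_ne_zero ha))
  have hG : ∀ w, w ≠ 0 → g w = φ (a * ψ w) := fun w hw => by
    rw [← hg' _ (H.ne' w hw), H.φψ w hw]
  have hK : ∀ w, w ≠ 0 → k w = φ (a⁻¹ * ψ w) := fun w hw => by
    rw [← hk' _ (H.ne' w hw), H.φψ w hw]
  have hp : AutPair g k := by
    refine ⟨hg, hk, fun w hw => ?_, fun w hw => ?_⟩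
    · have := H.ne' w hw
      rw [hG w hw, hk' _ (mul_ne_zero ha this), inv_mul_cancel_left₀ ha, H.φψ w hw]
    · have := H.ne' w hw
      rw [hK w hw, hg' _ (mul_ne_zero (inv_ne_zero ha) this), mul_inv_cancel_left₀ ha, H.φψ w hw]
  obtain ⟨c, -, hc⟩ := hp.linear_of_no_fix (by
    intro w hw h
    have h0 := H.ne' w hw
    rw [hG w hw] at h
    have h2 := congrArg ψ h
    rw [H.ψφ _ (mul_ne_zero ha h0)] at h2
    exact ha1 (mul_right_cancel₀ h0 (by rw [h2, one_mul])))
  have e1 := hg' 1 one_ne_zero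
  rw [H.one, hc 1 one_ne_zero, mul_one, mul_one] at e1
  rw [← hg' b hb, hc _ (H.ne b hb), e1]

lemma NConj.mul' (H : NConj φ ψ) {a b : ℂ} (ha : a ≠ 0) (hb : b ≠ 0) :
    ψ (a * b) = ψ a * ψ b := by
  have h1 := H.ne' a ha
  have h2 := H.ne' b hb
  rw [← H.ψφ _ (mul_ne_zero h1 h2), H.mul h1 h2, H.φψ a ha, H.φψ b hb]

lemma NConj.one' (H : NConj φ ψ) : ψ 1 = 1 := by
  have := H.ψφ 1 one_ne_zero
  rwa [H.one] at this

lemma exists_entire (z : ℕ → ℂ) (hz : ∀ n, (2:ℝ) ^ n ≤ ‖z n‖) :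
    ∃ h : ℂ → ℂ, Differentiable ℂ h ∧ h 0 = 1 ∧ ∀ n, h (z n) = 0 := by
  have hz0 : ∀ n, z n ≠ 0 := fun n h => by
    have := hz n
    rw [h, norm_zero] at this
    have : (0:ℝ) < 2 ^ n := by positivity
    linarith
  refine ⟨fun x => ∏' n, (1 + -(x / z n)), ?_, ?_, ?_⟩
  · intro x
    set R := ‖x‖ + 1 with hR
    have hu : Summable (fun n : ℕ => R * (1 / 2 : ℝ) ^ n) := summable_geometric_two.mul_left R
    have := Summable.hasProdLocallyUniformlyOn_nat_one_add (K := Metric.ball (0:ℂ) R)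
      (f := fun n x => -(x / z n)) Metric.isOpen_ball hu
      (Eventually.of_forall fun n y hy => by
        rw [norm_neg, norm_div, one_div, inv_pow, ← div_eq_mul_inv]
        have : ‖y‖ < R := by simpa using hy
        exact div_le_div₀ (by positivity) this.le (by positivity) (hz n))
      (fun n => by fun_prop)
    have hd := TendstoLocallyUniformlyOn.differentiableOn (hasProdLocallyUniformlyOn_iff_tendstoLocallyUniformlyOn.mp this)
      (Eventually.of_forall fun s => by
        apply DifferentiableOn.fun_finsetProd
        intro n _
        fun_prop) Metric.isOpen_ball
    exact hd.differentiableAt (Metric.isOpen_ball.mem_nhds (by simp [hR]))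
  · simp
  · intro n
    exact tprod_of_exists_eq_zero ⟨n, by simp [hz0 n]⟩

lemma conn_Cstar : IsPreconnected Cstar := by
  have : Cstar = Complex.exp '' univ := by
    ext z
    constructor
    · intro hz
      exact ⟨Complex.log z, trivial, Complex.exp_log hz⟩
    · rintro ⟨t, -, rfl⟩
      exact Complex.exp_ne_zero _
  rw [this]
  exact isPreconnected_univ.image _ Complex.continuous_exp.continuousOn

lemma NConj.bdd (H : NConj φ ψ) :
    ∃ C : ℝ, ∀ w : ℂ, w ∈ Metric.closedBall (1:ℂ) (1/2) → ‖ψ w‖ ≤ C := by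
  by_contra hcon
  push Not at hcon
  set K := Metric.closedBall (1:ℂ) (1/2) with hKdef
  have hK0 : ∀ w ∈ K, w ≠ 0 := by
    rintro w hw rfl
    rw [hKdef, Metric.mem_closedBall] at hw
    norm_num at hw
  have hstep : ∀ (n : ℕ) (C : ℝ), ∃ w ∈ K, max C (2 ^ n) < ‖ψ w‖ := fun n C => hcon _
  choose! w hwK hw using hstep
  -- recursive sequence
  let x : ℕ → ℂ := fun n => Nat.rec (w 0 0) (fun n y => w (n+1) ‖ψ y‖) n
  have hx0 : x 0 = w 0 0 := rfl
  have hxs : ∀ n, x (n+1) = w (n+1) ‖ψ (x n)‖ := fun n => rfl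
  have hxK : ∀ n, x n ∈ K := by
    intro n; cases n with
    | zero => rw [hx0]; exact hwK _ _
    | succ n => rw [hxs]; exact hwK _ _
  have hx2 : ∀ n, (2:ℝ)^n ≤ ‖ψ (x n)‖ := by
    intro n; cases n with
    | zero => rw [hx0]; exact (le_max_right _ _).trans (hw _ _).le
    | succ n => rw [hxs]; exact (le_max_right _ _).trans (hw _ _).le
  have hmono : StrictMono (fun n => ‖ψ (x n)‖) := by
    apply strictMono_nat_of_lt_succ
    intro n
    rw [hxs]
    exact (le_max_left _ _).trans_lt (hw _ _)
  have hinj : Function.Injective x := fun a b hab => hmono.injective (by simp [hab])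
  obtain ⟨h, hh, h0, hzero⟩ := exists_entire (fun n => ψ (x n)) hx2
  obtain ⟨g, hg, hg'⟩ := H.conj _ (endo_exp hh)
  have hgx : ∀ n, g (x n) = 1 := by
    intro n
    have h1 := hK0 _ (hxK n)
    have := hg' _ (H.ne' _ h1)
    rw [H.φψ _ h1] at this
    rw [this, hzero n, Complex.exp_zero, H.one]
  obtain ⟨p, hpK, hp⟩ := (infinite_range_of_injective hinj).exists_accPt_of_subset_isCompact
    (isCompact_closedBall (1:ℂ) (1/2)) (by rintro _ ⟨n, rfl⟩; exact hxK n)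
  have hfreq : ∃ᶠ y in 𝓝[≠] p, g y = 1 := by
    rw [accPt_iff_frequently_nhdsNE] at hp
    exact hp.mono (by rintro _ ⟨n, rfl⟩; exact hgx n)
  have hE : EqOn g (fun _ => 1) Cstar :=
    (hg.1.analyticOnNhd isOpen_Cstar).eqOn_of_preconnected_of_frequently_eq
      analyticOnNhd_const conn_Cstar (hK0 p hpK) hfreq
  have hexp : ∀ z, z ≠ 0 → Complex.exp (h z) = 1 := by
    intro z hz
    have e1 := hg' z hz
    rw [hE (H.ne z hz)] at e1
    have e2 := congrArg ψ e1
    rw [H.ψφ _ (Complex.exp_ne_zero _), H.one'] at e2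
    exact e2.symm
  have ht : Tendsto (fun z => Complex.exp (h z)) (𝓝[≠] 0) (𝓝 (Complex.exp (h 0))) :=
    (hh.cexp.continuous.tendsto 0).mono_left nhdsWithin_le_nhds
  have ht2 : Tendsto (fun z => Complex.exp (h z)) (𝓝[≠] 0) (𝓝 1) := by
    refine tendsto_const_nhds.congr' ?_
    filter_upwards [self_mem_nhdsWithin] with z hz using (hexp z hz).symm
  have := tendsto_nhds_unique ht ht2
  rw [h0] at this
  have h3 := congrArg norm this
  rw [Complex.norm_exp] at h3
  simp at h3


lemma NConj.log_norm (H : NConj φ ψ) :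
    ∃ c : ℝ, c ≠ 0 ∧ ∀ w, w ≠ 0 → Real.log ‖ψ w‖ = c * Real.log ‖w‖ := by
  obtain ⟨C, hC⟩ := H.bdd
  have hne : ∀ t, ‖ψ (Complex.exp t)‖ ≠ 0 := fun t =>
    norm_ne_zero_iff.2 (H.ne' _ (Complex.exp_ne_zero t))
  let L : ℂ →+ ℝ :=
    { toFun := fun t => Real.log ‖ψ (Complex.exp t)‖
      map_zero' := by simp [H.one']
      map_add' := fun a b => by
        rw [Complex.exp_add, H.mul' (Complex.exp_ne_zero a) (Complex.exp_ne_zero b), norm_mul,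
          Real.log_mul (hne a) (hne b)] }
  have hL : ∀ t, L t = Real.log ‖ψ (Complex.exp t)‖ := fun t => rfl
  have hnb : ∀ᶠ t in 𝓝 (0:ℂ), Complex.exp t ∈ Metric.closedBall (1:ℂ) (1/2) := by
    have : Tendsto Complex.exp (𝓝 0) (𝓝 1) := by
      simpa using Complex.continuous_exp.tendsto 0
    exact this.eventually (Metric.closedBall_mem_nhds _ (by norm_num))
  have hnb2 : ∀ᶠ t in 𝓝 (0:ℂ), Complex.exp (-t) ∈ Metric.closedBall (1:ℂ) (1/2) := by
    have : Tendsto (fun t : ℂ => -t) (𝓝 0) (𝓝 0) := by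
      simpa using (continuous_neg (G := ℂ)).tendsto 0
    exact this.eventually hnb
  have hub : ∀ t, Complex.exp t ∈ Metric.closedBall (1:ℂ) (1/2) → L t ≤ Real.log C := by
    intro t ht
    rw [hL]
    exact Real.log_le_log (norm_pos_iff.2 (H.ne' _ (Complex.exp_ne_zero t))) (hC _ ht)
  have hcont : Continuous L := by
    refine L.continuous_of_isBounded_nhds_zero (hnb.and hnb2) ?_
    rw [isBounded_iff_forall_norm_le]
    refine ⟨Real.log C, ?_⟩
    rintro _ ⟨t, ⟨h1, h2⟩, rfl⟩
    have e1 := hub t h1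
    have e2 := hub (-t) h2
    rw [map_neg] at e2
    rw [Real.norm_eq_abs, abs_le]
    constructor <;> linarith
  have hI : L Complex.I = 0 := by
    have h1 : L ((2 * Real.pi : ℝ) • Complex.I) = 0 := by
      rw [hL]
      have : ((2 * Real.pi : ℝ) • Complex.I) = 2 * Real.pi * Complex.I := by
        rw [Complex.real_smul]; push_cast; ring
      rw [this, Complex.exp_two_pi_mul_I, H.one']; simp
    rw [map_real_smul L hcont, smul_eq_mul] at h1
    rcases mul_eq_zero.1 h1 with h | h
    · exact absurd h (by positivity)
    · exact h
  have hlin : ∀ t : ℂ, L t = L 1 * t.re := by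
    intro t
    have : t = t.re • (1:ℂ) + t.im • Complex.I := by
      simp [Complex.real_smul, Complex.re_add_im]
    conv_lhs => rw [this]
    rw [map_add, map_real_smul L hcont, map_real_smul L hcont, hI]
    simp [mul_comm]
  have hmain : ∀ w, w ≠ 0 → Real.log ‖ψ w‖ = L 1 * Real.log ‖w‖ := by
    intro w hw
    have := hlin (Complex.log w)
    rwa [hL, Complex.exp_log hw, Complex.log_re] at this
  refine ⟨L 1, ?_, hmain⟩
  intro h0
  have := hmain (φ 2) (H.ne 2 two_ne_zero)
  rw [H.ψφ 2 two_ne_zero, h0, zero_mul] at this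
  have h2 : 0 < Real.log ‖(2:ℂ)‖ := Real.log_pos (by norm_num)
  linarith

lemma log_deriv_line {G : ℂ → ℂ} (hG : Differentiable ℂ G) (hG0 : ∀ t, G t ≠ 0) (t h : ℂ) :
    HasDerivAt (fun s : ℝ => Real.log ‖G (t + s * h)‖) (h * (deriv G t / G t)).re 0 := by
  have e : ∀ s : ℝ, Real.log ‖G (t + s * h)‖ =
      (Complex.log (G (t + s * h) / G t)).re + Real.log ‖G t‖ := by
    intro s
    rw [Complex.log_re, norm_div, Real.log_div (norm_ne_zero_iff.2 (hG0 _))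
      (norm_ne_zero_iff.2 (hG0 _))]
    ring
  simp_rw [e]
  apply HasDerivAt.add_const
  have h1 : HasDerivAt (fun s : ℂ => t + s * h) h ((0:ℝ):ℂ) := by
    simpa using ((hasDerivAt_id ((0:ℝ):ℂ)).mul_const h).const_add t
  have h2 : HasDerivAt (fun s : ℂ => G (t + s * h)) (deriv G t * h) ((0:ℝ):ℂ) := by
    have h3 : HasDerivAt G (deriv G t) (t + ((0:ℝ):ℂ) * h) := by
      simpa using (hG t).hasDerivAt
    exact h3.comp ((0:ℝ):ℂ) h1
  have h4 := (h2.div_const (G t)).clog (by simp [hG0 t])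
  have h5 := h4.real_of_complex
  have e5 : (h * (deriv G t / G t)).re
      = (deriv G t * h / G t / (G (t + ((0:ℝ):ℂ) * h) / G t)).re := by
    congr 1
    have := hG0 t
    rw [Complex.ofReal_zero, zero_mul, add_zero, div_self this, div_one]
    ring
  rw [e5]
  exact h5

lemma endgame {E G₁ G₂ : ℂ → ℂ} {c : ℝ} (hmul : ∀ a b, E (a + b) = E a * E b) (h0 : E 0 = 1)
    (hnc : E 1 ≠ 1)
    (hG₁ : Differentiable ℂ G₁) (hG₁0 : ∀ t, G₁ t ≠ 0)
    (hG₂ : Differentiable ℂ G₂) (hG₂0 : ∀ t, G₂ t ≠ 0)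
    (hre : ∀ t, (E t).re = c * Real.log ‖G₁ t‖) (him : ∀ t, (E t).im = c * Real.log ‖G₂ t‖) :
    Differentiable ℂ E ∨ Differentiable ℂ (fun t => (starRingEnd ℂ) (E t)) := by
  set A : ℂ → ℂ := fun t => deriv G₁ t / G₁ t with hA
  set B : ℂ → ℂ := fun t => deriv G₂ t / G₂ t with hB
  have hAd : Differentiable ℂ A := hG₁.deriv.fun_div hG₁ hG₁0
  have hBd : Differentiable ℂ B := hG₂.deriv.fun_div hG₂ hG₂0
  set X : ℂ → ℂ → ℂ := fun t h => c * (((h * A t).re : ℂ) + ((h * B t).re : ℂ) * Complex.I) with hX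
  have hEX : ∀ t h, HasDerivAt (fun s : ℝ => E (t + s * h)) (X t h) 0 := by
    intro t h
    have e : ∀ s : ℝ, E (t + s * h) = c * ((Real.log ‖G₁ (t + s * h)‖ : ℂ) +
        (Real.log ‖G₂ (t + s * h)‖ : ℂ) * Complex.I) := by
      intro s
      rw [← Complex.re_add_im (E (t + s * h)), hre, him]
      push_cast; ring
    simp_rw [e]
    exact ((log_deriv_line hG₁ hG₁0 t h).ofReal_comp.add
      ((log_deriv_line hG₂ hG₂0 t h).ofReal_comp.mul_const Complex.I)).const_mul (c:ℂ)
  have hXE : ∀ t h, X t h = E t * X 0 h := by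
    intro t h
    have h1 := (hEX 0 h).const_mul (E t)
    refine (hEX t h).unique ?_
    have e : (fun s : ℝ => E (t + s * h)) = fun s : ℝ => E t * E (0 + s * h) := by
      funext s
      rw [← hmul, zero_add]
    rw [e]
    exact h1
  -- the two constants
  set P := X 0 1 - Complex.I * X 0 Complex.I with hP
  set Q := X 0 1 + Complex.I * X 0 Complex.I with hQ
  have hPE : ∀ t, E t * P = c * (A t + Complex.I * B t) := by
    intro t
    have h1 := hXE t 1
    have h2 := hXE t Complex.I
    have : E t * P = X t 1 - Complex.I * X t Complex.I := by rw [h1, h2, hP]; ring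
    rw [this, hX]
    apply Complex.ext <;> simp <;> ring
  have hQE : ∀ t, (starRingEnd ℂ) (E t) * (starRingEnd ℂ) Q = c * (A t - Complex.I * B t) := by
    intro t
    have h1 := hXE t 1
    have h2 := hXE t Complex.I
    have : E t * Q = X t 1 + Complex.I * X t Complex.I := by rw [h1, h2, hQ]; ring
    rw [← map_mul, this, hX]
    apply Complex.ext <;> simp <;> ring
  by_cases hP0 : P = 0
  · by_cases hQ0 : Q = 0
    · exfalso
      have hX1 : X 0 1 = 0 := by
        have : X 0 1 = (P + Q) / 2 := by rw [hP, hQ]; ring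
        rw [this, hP0, hQ0]; simp
      have hd : ∀ s : ℝ, HasDerivAt (fun s : ℝ => E s) 0 s := by
        intro s
        have h1 := hEX s 1
        rw [hXE, hX1, mul_zero] at h1
        have h2 : HasDerivAt (fun r : ℝ => r - s) 1 s := (hasDerivAt_id s).sub_const s
        have h3 : HasDerivAt (fun r : ℝ => E (s + r * 1)) 0 (s - s) := by simpa using h1
        have h4 := HasDerivAt.scomp (h := fun r : ℝ => r - s) s h3 h2
        simpa [Function.comp_def] using h4
      have hc := is_const_of_deriv_eq_zero (f := fun s : ℝ => E s)
        (fun s => (hd s).differentiableAt) (fun s => (hd s).deriv) 1 0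
      simp at hc
      exact hnc (hc.trans h0)
    · right
      have : (fun t => (starRingEnd ℂ) (E t)) =
          fun t => c * (A t - Complex.I * B t) / (starRingEnd ℂ) Q := by
        funext t
        rw [← hQE, mul_div_cancel_right₀]
        simpa using hQ0
      rw [this]
      exact (((hAd.sub (hBd.const_mul _)).const_mul _).div_const _)
  · left
    have : E = fun t => c * (A t + Complex.I * B t) / P := by
      funext t
      rw [← hPE, mul_div_cancel_right₀ _ hP0]
    rw [this]
    exact (((hAd.add (hBd.const_mul _)).const_mul _).div_const _)

lemma exp_char {F : ℂ → ℂ} (hF : Differentiable ℂ F) (hmul : ∀ a b, F (a + b) = F a * F b)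
    (h0 : F 0 = 1) (hker : ∀ t, F t = 1 ↔ Complex.exp t = 1) :
    (∀ t, F t = Complex.exp t) ∨ (∀ t, F t = Complex.exp (-t)) := by
  set α := deriv F 0 with hα
  have hd : ∀ t, HasDerivAt F (F t * α) t := by
    intro t
    have h1 : HasDerivAt (fun s => F (s - t)) α t := by
      have : HasDerivAt F α (t - t) := by rw [sub_self]; exact (hF 0).hasDerivAt
      simpa using this.comp_sub_const t t
    have h2 := h1.const_mul (F t)
    refine h2.congr_of_eventuallyEq (Eventually.of_forall fun s => ?_)
    simp only [← hmul]; congr 1; ring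
  have hFe : ∀ t, F t = Complex.exp (α * t) := by
    intro t
    have hc : ∀ t, HasDerivAt (fun t => F t * Complex.exp (-(α * t))) 0 t := by
      intro t
      have h1 : HasDerivAt (fun t => Complex.exp (-(α * t))) (Complex.exp (-(α * t)) * (-(α * 1))) t :=
        (((hasDerivAt_id t).const_mul α).neg).cexp
      have h2 := (hd t).fun_mul h1
      have e : F t * α * Complex.exp (-(α * t)) + F t * (Complex.exp (-(α * t)) * (-(α * 1))) = 0 := by
        ring
      rwa [e] at h2
    have := is_const_of_deriv_eq_zero (fun t => (hc t).differentiableAt) (fun t => (hc t).deriv) t 0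
    simp only [h0, mul_zero, neg_zero, Complex.exp_zero, mul_one] at this
    rw [Complex.exp_neg] at this
    exact (mul_inv_eq_one₀ (Complex.exp_ne_zero _)).1 this
  have hpi : (2 * Real.pi * Complex.I : ℂ) ≠ 0 := Complex.two_pi_I_ne_zero
  have hα0 : α ≠ 0 := by
    intro h
    have h1 : F (Real.log 2 : ℝ) = 1 := by rw [hFe, h]; simp
    rw [hker, ← Complex.ofReal_exp, Real.exp_log two_pos] at h1
    norm_num at h1
  obtain ⟨m, hm⟩ : ∃ m : ℤ, α = m := by
    have h1 := (hker (2 * Real.pi * Complex.I)).2 Complex.exp_two_pi_mul_I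
    rw [hFe, Complex.exp_eq_one_iff] at h1
    obtain ⟨m, hm⟩ := h1
    exact ⟨m, mul_right_cancel₀ hpi hm⟩
  obtain ⟨n, hn⟩ : ∃ n : ℤ, 1 = α * n := by
    have h1 := (hker (2 * Real.pi * Complex.I / α)).1 (by
      rw [hFe, mul_div_cancel₀ _ hα0, Complex.exp_two_pi_mul_I])
    rw [Complex.exp_eq_one_iff] at h1
    obtain ⟨n, hn⟩ := h1
    refine ⟨n, mul_right_cancel₀ hpi ?_⟩
    field_simp at hn
    rw [one_mul]
    linear_combination (2 * Real.pi * Complex.I) * hn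
  have hmn : m * n = 1 := by
    rw [hm] at hn; exact_mod_cast hn.symm
  rcases Int.eq_one_or_neg_one_of_mul_eq_one hmn with h | h
  · left; intro t; rw [hFe, hm, h]; simp
  · right; intro t; rw [hFe, hm, h]; simp

lemma NConj.classify (H : NConj φ ψ) :
    (∀ w, w ≠ 0 → ψ w = w) ∨ (∀ w, w ≠ 0 → ψ w = w⁻¹) ∨
    (∀ w, w ≠ 0 → ψ w = (starRingEnd ℂ) w) ∨ (∀ w, w ≠ 0 → ψ w = ((starRingEnd ℂ) w)⁻¹) := by
  obtain ⟨c, hc0, hc⟩ := H.log_norm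
  have hφn : ∀ y, y ≠ 0 → c * Real.log ‖φ y‖ = Real.log ‖y‖ := by
    intro y hy
    rw [← hc _ (H.ne y hy), H.ψφ y hy]
  set E : ℂ → ℂ := fun t => ψ (Complex.exp t) with hE
  have hmul : ∀ a b, E (a + b) = E a * E b := fun a b => by
    simp only [hE, Complex.exp_add]
    exact H.mul' (Complex.exp_ne_zero a) (Complex.exp_ne_zero b)
  have h0 : E 0 = 1 := by simp [hE, H.one']
  have hker : ∀ t, E t = 1 ↔ Complex.exp t = 1 := by
    intro t
    constructor
    · intro h
      have := congrArg φ h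
      rwa [hE, H.φψ _ (Complex.exp_ne_zero t), H.one] at this
    · intro h
      simp only [hE, h, H.one']
  have hnc : E 1 ≠ 1 := by
    intro h
    have h3 := congrArg norm ((hker 1).1 h)
    rw [Complex.norm_exp] at h3
    simp at h3
  have hgen : ∀ a : ℂ, ∃ G : ℂ → ℂ, Differentiable ℂ G ∧ (∀ t, G t ≠ 0) ∧
      ∀ t, (a * E t).re = c * Real.log ‖G t‖ := by
    intro a
    obtain ⟨g, hg, hg'⟩ := H.conj (fun z => Complex.exp (a * z))
      (endo_exp (differentiable_id.const_mul a))
    refine ⟨fun t => g (Complex.exp t), ?_, fun t => hg.ne (Complex.exp_ne_zero t), ?_⟩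
    · intro t
      exact (hg.1.differentiableAt (isOpen_Cstar.mem_nhds (Complex.exp_ne_zero t))).comp t
        Complex.differentiable_exp.differentiableAt
    · intro t
      have h1 := Complex.exp_ne_zero t
      have h2 := hg' _ (H.ne' _ h1)
      rw [H.φψ _ h1] at h2
      simp only [h2]
      rw [hφn _ (Complex.exp_ne_zero _), Complex.norm_exp, Real.log_exp]
  obtain ⟨G₁, hG₁, hG₁0, hre⟩ := hgen 1
  obtain ⟨G₂, hG₂, hG₂0, him⟩ := hgen (-Complex.I)
  have hlog : ∀ w, w ≠ 0 → ψ w = E (Complex.log w) := fun w hw => by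
    simp only [hE, Complex.exp_log hw]
  rcases endgame hmul h0 hnc hG₁ hG₁0 hG₂ hG₂0 (fun t => by simpa using hre t)
    (fun t => by simpa using him t) with hd | hd
  · rcases exp_char hd hmul h0 hker with h | h
    · left; intro w hw; rw [hlog w hw, h, Complex.exp_log hw]
    · right; left; intro w hw; rw [hlog w hw, h, Complex.exp_neg, Complex.exp_log hw]
  · have key : ∀ x y : ℂ, (starRingEnd ℂ) x = y → x = (starRingEnd ℂ) y := by
      rintro x _ rfl; simp
    rcases exp_char hd (fun a b => by simp [hmul]) (by simp [h0]) (fun t => by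
      rw [← hker t, map_eq_one_iff _ (starRingEnd ℂ).injective]) with h | h
    · right; right; left; intro w hw
      rw [hlog w hw, key _ _ (h _), Complex.exp_log hw]
    · right; right; right; intro w hw
      rw [hlog w hw, key _ _ (h _), Complex.exp_neg, Complex.exp_log hw, map_inv₀]

lemma conclude {b : ℂ} (hb : b ≠ 0) (F : ℂ → ℂ)
    (h : (∀ z, z ≠ 0 → F z = b * z) ∨ (∀ z, z ≠ 0 → F z = b * z⁻¹)) :
    DifferentiableOn ℂ F Cstar ∧
      ∃ ψ : ℂ → ℂ, DifferentiableOn ℂ ψ Cstar ∧ Set.InvOn ψ F Cstar Cstar := by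
  have hinv : DifferentiableOn ℂ (fun z : ℂ => z⁻¹) Cstar :=
    differentiableOn_id.inv (fun z hz => hz)
  rcases h with h | h
  · refine ⟨DifferentiableOn.congr (differentiableOn_id.const_mul b) h,
      fun z => b⁻¹ * z, differentiableOn_id.const_mul _, ?_, ?_⟩
    · intro z hz
      simp only [h z hz]
      rw [inv_mul_cancel_left₀ hb]
    · intro z hz
      rw [h _ (mul_ne_zero (inv_ne_zero hb) hz), mul_inv_cancel_left₀ hb]
  · refine ⟨DifferentiableOn.congr (hinv.const_mul b) h,
      fun z => b * z⁻¹, hinv.const_mul _, ?_, ?_⟩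
    · intro z hz
      simp only [h z hz]
      rw [mul_inv, inv_inv, mul_inv_cancel_left₀ hb]
    · intro z hz
      rw [h _ (mul_ne_zero hb (inv_ne_zero hz)), mul_inv, inv_inv, mul_inv_cancel_left₀ hb]

/-- a conjugating mapping of `ℂ*` is biholomorphic or anti-biholomorphic. -/
theorem stmt1 (φ : ℂ → ℂ) (hφ : ConjugatingCstar φ) :
    (DifferentiableOn ℂ φ Cstar ∧
      ∃ ψ : ℂ → ℂ, DifferentiableOn ℂ ψ Cstar ∧ Set.InvOn ψ φ Cstar Cstar) ∨
    (DifferentiableOn ℂ (fun z => φ (starRingEnd ℂ z)) Cstar ∧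
      ∃ ψ : ℂ → ℂ, DifferentiableOn ℂ ψ Cstar ∧
        Set.InvOn ψ (fun z => φ (starRingEnd ℂ z)) Cstar Cstar) := by
  obtain ⟨hbij, hconj⟩ := hφ
  set b := φ 1 with hbdef
  have hb : b ≠ 0 := hbij.mapsTo (show (1:ℂ) ∈ Cstar from one_ne_zero)
  set χ := Function.invFunOn φ Cstar with hχ
  have hinv : InvOn χ φ Cstar Cstar := hbij.invOn_invFunOn
  have hχm : MapsTo χ Cstar Cstar := hbij.surjOn.mapsTo_invFunOn
  have H : NConj (fun z => b⁻¹ * φ z) (fun w => χ (b * w)) := by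
    refine ⟨fun z hz => mul_ne_zero (inv_ne_zero hb) (hbij.mapsTo hz),
      fun z hz => hχm (mul_ne_zero hb hz), fun z hz => ?_, fun z hz => ?_, ?_, ?_⟩
    · simp only [mul_inv_cancel_left₀ hb]
      exact hinv.1 hz
    · have := hinv.2 (show b * z ∈ Cstar from mul_ne_zero hb hz)
      simp only [this]
      rw [inv_mul_cancel_left₀ hb]
    · exact inv_mul_cancel₀ hb
    · intro f hf
      obtain ⟨g, hg, hg'⟩ := hconj f hf
      refine ⟨fun w => b⁻¹ * g (b * w), ⟨?_, ?_⟩, ?_⟩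
      · exact (hg.1.comp (differentiableOn_id.const_mul b)
          (fun z hz => mul_ne_zero hb hz)).const_mul _
      · intro z hz
        exact mul_ne_zero (inv_ne_zero hb) (hg.2 (mul_ne_zero hb hz : b * z ∈ Cstar))
      · intro z hz
        simp only [mul_inv_cancel_left₀ hb, hg' z hz]
  -- recover φ from the inverse
  have hrec : ∀ z w, w ≠ 0 → χ (b * w) = z → φ z = b * w := by
    rintro _ w hw rfl
    exact hinv.2 (show b * w ∈ Cstar from mul_ne_zero hb hw)
  have hcne : ∀ z : ℂ, z ≠ 0 → (starRingEnd ℂ) z ≠ 0 := fun z hz => by simpa using hz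
  rcases H.classify with h | h | h | h
  · exact Or.inl (conclude hb φ (Or.inl fun z hz => hrec z z hz (h z hz)))
  · refine Or.inl (conclude hb φ (Or.inr fun z hz => hrec z _ (inv_ne_zero hz) ?_))
    simpa using h _ (inv_ne_zero hz)
  · refine Or.inr (conclude hb _ (Or.inl fun z hz => hrec _ z hz (h z hz)))
  · refine Or.inr (conclude hb _ (Or.inr fun z hz => hrec _ _ (inv_ne_zero hz) ?_))
    simpa using h _ (inv_ne_zero hz)
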